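/- Bilinear estimate for ψx against a uniformly bounded grid function: let c₀ ≥ 0 and let U, ρ, e be periodic grid functions on the M₁×M₂ periodic grid with step size h > 0 such that |U(p,q)| ≤ c₀ and |(δ̂x U)(p,q)| ≤ c₀ for all grid points (p,q). Then |⟨ψx(ρ, U), e⟩| ≤ (c₀/3)·‖ρ‖·‖e‖ + (c₀/3)·‖ρ‖·‖δ̂x e‖. The analogous estimate holds for ψy with δ̂y in place of δ̂x. -/

import Mathlib

open Real Finset Asymptotics

/-- A periodic grid function on the `M₁ × M₂` periodic grid. -/
abbrev GridFun (M₁ M₂ : ℕ) : Type := ZMod M₁ × ZMod M₂ → ℝ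

variable {M₁ M₂ : ℕ}

/-- Discrete inner product `⟨u,v⟩ = h² Σ_a Σ_b u(a,b) v(a,b)`. -/
noncomputable def gip [NeZero M₁] [NeZero M₂] (h : ℝ) (u v : GridFun M₁ M₂) : ℝ :=
  h ^ 2 * ∑ a : ZMod M₁, ∑ b : ZMod M₂, u (a, b) * v (a, b)

/-- Discrete L² norm. -/
noncomputable def gnorm [NeZero M₁] [NeZero M₂] (h : ℝ) (v : GridFun M₁ M₂) : ℝ :=
  Real.sqrt (gip h v v)

/-- Forward difference in `x`. -/
noncomputable def dx (h : ℝ) (v : GridFun M₁ M₂) : GridFun M₁ M₂ :=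
  fun p => (v (p.1 + 1, p.2) - v p) / h

/-- Forward difference in `y`. -/
noncomputable def dy (h : ℝ) (v : GridFun M₁ M₂) : GridFun M₁ M₂ :=
  fun p => (v (p.1, p.2 + 1) - v p) / h

/-- Central difference in `x`. -/
noncomputable def dhx (h : ℝ) (v : GridFun M₁ M₂) : GridFun M₁ M₂ :=
  fun p => (v (p.1 + 1, p.2) - v (p.1 - 1, p.2)) / (2 * h)

/-- Central difference in `y`. -/
noncomputable def dhy (h : ℝ) (v : GridFun M₁ M₂) : GridFun M₁ M₂ :=
  fun p => (v (p.1, p.2 + 1) - v (p.1, p.2 - 1)) / (2 * h)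

/-- Second difference in `x`. -/
noncomputable def dxx (h : ℝ) (v : GridFun M₁ M₂) : GridFun M₁ M₂ :=
  fun p => (v (p.1 + 1, p.2) - 2 * v p + v (p.1 - 1, p.2)) / h ^ 2

/-- Second difference in `y`. -/
noncomputable def dyy (h : ℝ) (v : GridFun M₁ M₂) : GridFun M₁ M₂ :=
  fun p => (v (p.1, p.2 + 1) - 2 * v p + v (p.1, p.2 - 1)) / h ^ 2

/-- Combined central difference `δ̂h = δ̂x + δ̂y`. -/
noncomputable def dhath (h : ℝ) (v : GridFun M₁ M₂) : GridFun M₁ M₂ :=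
  fun p => dhx h v p + dhy h v p

/-- Discrete H¹ seminorm. -/
noncomputable def snorm1 [NeZero M₁] [NeZero M₂] (h : ℝ) (v : GridFun M₁ M₂) : ℝ :=
  Real.sqrt (gnorm h (dx h v) ^ 2 + gnorm h (dy h v) ^ 2)

/-- Bilinear operator `ψx(u,v) = (1/3)(u δ̂x v + δ̂x (u v))`. -/
noncomputable def psix (h : ℝ) (u v : GridFun M₁ M₂) : GridFun M₁ M₂ :=
  fun p => (1 / 3 : ℝ) * (u p * dhx h v p + dhx h (fun q => u q * v q) p)

/-- Bilinear operator `ψy(u,v) = (1/3)(u δ̂y v + δ̂y (u v))`. -/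
noncomputable def psiy (h : ℝ) (u v : GridFun M₁ M₂) : GridFun M₁ M₂ :=
  fun p => (1 / 3 : ℝ) * (u p * dhy h v p + dhy h (fun q => u q * v q) p)

/-- Bilinear operator `ψh(u,v) = (1/3)(u δ̂h v + δ̂h (u v))`. -/
noncomputable def psih (h : ℝ) (u v : GridFun M₁ M₂) : GridFun M₁ M₂ :=
  fun p => (1 / 3 : ℝ) * (u p * dhath h v p + dhath h (fun q => u q * v q) p)

theorem gip_eq_sum_prod [NeZero M₁] [NeZero M₂] (h : ℝ) (u v : GridFun M₁ M₂) :
    gip h u v = h ^ 2 * ∑ p, u p * v p := by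
  rw [gip, Fintype.sum_prod_type]

/-- Cauchy–Schwarz with a bounded weight. -/
theorem abs_gip_mul_le [NeZero M₁] [NeZero M₂] {h c : ℝ} {w : GridFun M₁ M₂}
    (hw : ∀ p, |w p| ≤ c) (u v : GridFun M₁ M₂) :
    |gip h (fun p => u p * w p) v| ≤ c * gnorm h u * gnorm h v := by
  have hc : 0 ≤ c := (abs_nonneg _).trans (hw 0)
  have hsum : |∑ p, u p * w p * v p| ≤ c * (√(∑ p, u p ^ 2) * √(∑ p, v p ^ 2)) := by
    calc |∑ p, u p * w p * v p| ≤ ∑ p, |u p * w p * v p| := Finset.abs_sum_le_sum_abs _ _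
      _ ≤ ∑ p, c * (|u p| * |v p|) := by
          refine Finset.sum_le_sum fun p _ => ?_
          rw [abs_mul, abs_mul, mul_comm |u p|, mul_assoc]
          exact mul_le_mul_of_nonneg_right (hw p) (by positivity)
      _ = c * ∑ p, |u p| * |v p| := by rw [Finset.mul_sum]
      _ ≤ c * (√(∑ p, u p ^ 2) * √(∑ p, v p ^ 2)) := by
          refine mul_le_mul_of_nonneg_left ?_ hc
          simpa only [sq_abs] using
            Real.sum_mul_le_sqrt_mul_sqrt Finset.univ (fun p => |u p|) fun p => |v p|
  have hnorm (f : GridFun M₁ M₂) : gnorm h f = |h| * √(∑ p, f p ^ 2) := by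
    rw [gnorm, gip_eq_sum_prod, Real.sqrt_mul (sq_nonneg h), Real.sqrt_sq_eq_abs]
    simp only [sq]
  rw [gip_eq_sum_prod, hnorm, hnorm, abs_mul, abs_of_nonneg (sq_nonneg h), ← sq_abs h]
  calc |h| ^ 2 * |∑ p, u p * w p * v p|
      ≤ |h| ^ 2 * (c * (√(∑ p, u p ^ 2) * √(∑ p, v p ^ 2))) :=
        mul_le_mul_of_nonneg_left hsum (by positivity)
    _ = _ := by ring

/-- Summation by parts for the central difference in the direction `s`. -/
theorem gip_centralDiff_left [NeZero M₁] [NeZero M₂] (h : ℝ) (s : ZMod M₁ × ZMod M₂)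
    (f g : GridFun M₁ M₂) :
    gip h (fun p => (f (p + s) - f (p - s)) / (2 * h)) g =
      -gip h f fun p => (g (p + s) - g (p - s)) / (2 * h) := by
  have h₁ : ∑ p, f (p + s) * g p = ∑ p, f p * g (p - s) :=
    Fintype.sum_equiv (Equiv.addRight s) _ _ fun p => by simp
  have h₂ : ∑ p, f (p - s) * g p = ∑ p, f p * g (p + s) :=
    Fintype.sum_equiv (Equiv.subRight s) _ _ fun p => by simp
  simp only [gip_eq_sum_prod, div_mul_eq_mul_div, mul_div_assoc', ← Finset.sum_div, sub_mul,
    mul_sub, Finset.sum_sub_distrib, h₁, h₂]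
  ring

theorem gip_dhx_left [NeZero M₁] [NeZero M₂] (h : ℝ) (f g : GridFun M₁ M₂) :
    gip h (dhx h f) g = -gip h f (dhx h g) := by
  have hdhx (v : GridFun M₁ M₂) :
      dhx h v = fun p => (v (p + (1, 0)) - v (p - (1, 0))) / (2 * h) := by
    ext ⟨a, b⟩
    simp [dhx]
  rw [hdhx, hdhx, gip_centralDiff_left]

theorem gip_dhy_left [NeZero M₁] [NeZero M₂] (h : ℝ) (f g : GridFun M₁ M₂) :
    gip h (dhy h f) g = -gip h f (dhy h g) := by
  have hdhy (v : GridFun M₁ M₂) :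
      dhy h v = fun p => (v (p + (0, 1)) - v (p - (0, 1))) / (2 * h) := by
    ext ⟨a, b⟩
    simp [dhy]
  rw [hdhy, hdhy, gip_centralDiff_left]

/-- The bilinear estimate for an arbitrary skew-adjoint operator `D`. -/
theorem abs_gip_bilinear_le_of_skewAdjoint [NeZero M₁] [NeZero M₂] {h c : ℝ}
    {D : GridFun M₁ M₂ → GridFun M₁ M₂} (hD : ∀ f g, gip h (D f) g = -gip h f (D g))
    {U : GridFun M₁ M₂} (hU : ∀ p, |U p| ≤ c) (hDU : ∀ p, |D U p| ≤ c) (ρ e : GridFun M₁ M₂) :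
    |gip h (fun p => (1 / 3 : ℝ) * (ρ p * D U p + D (fun q => ρ q * U q) p)) e| ≤
      c / 3 * gnorm h ρ * gnorm h e + c / 3 * gnorm h ρ * gnorm h (D e) := by
  have hsplit : gip h (fun p => (1 / 3 : ℝ) * (ρ p * D U p + D (fun q => ρ q * U q) p)) e =
      1 / 3 * (gip h (fun p => ρ p * D U p) e - gip h (fun p => ρ p * U p) (D e)) := by
    rw [sub_eq_add_neg, ← hD]
    simp only [gip_eq_sum_prod, mul_assoc, add_mul, Finset.sum_add_distrib, ← Finset.mul_sum]
    ring
  have h₁ := abs_gip_mul_le (h := h) hDU ρ e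
  have h₂ := abs_gip_mul_le (h := h) hU ρ (D e)
  rw [hsplit, abs_mul, abs_of_pos (by norm_num : (0 : ℝ) < 1 / 3)]
  linarith [abs_sub (gip h (fun p => ρ p * D U p) e) (gip h (fun p => ρ p * U p) (D e))]

/-- Bilinear estimates for `ψx` and `ψy` against a uniformly bounded grid function. -/
theorem psix_psiy_bilinear_estimate [NeZero M₁] [NeZero M₂]
    (h c₀ : ℝ) (hh : 0 < h) (hc : 0 ≤ c₀)
    (U ρ e : GridFun M₁ M₂)
    (hU : ∀ p, |U p| ≤ c₀)
    (hdxU : ∀ p, |dhx h U p| ≤ c₀) (hdyU : ∀ p, |dhy h U p| ≤ c₀) :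
    |gip h (psix h ρ U) e| ≤
        c₀ / 3 * gnorm h ρ * gnorm h e + c₀ / 3 * gnorm h ρ * gnorm h (dhx h e) ∧
    |gip h (psiy h ρ U) e| ≤
        c₀ / 3 * gnorm h ρ * gnorm h e + c₀ / 3 * gnorm h ρ * gnorm h (dhy h e) := by
  exact ⟨abs_gip_bilinear_le_of_skewAdjoint (gip_dhx_left h) hU hdxU ρ e,
    abs_gip_bilinear_le_of_skewAdjoint (gip_dhy_left h) hU hdyU ρ e⟩
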